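/- Let p be a prime and F a field of characteristic p. Let L/F be a finite field extension and let C be a cyclic L-algebra of degree p. Then there exists a purely inseparable field extension K/F with [K:F] ≤ p^{[L:F]} such that C ⊗_L LK is split. Moreover, if L/F is separable, then K can be chosen so that K^p ⊆ F. -/

import Mathlib

open scoped TensorProduct

/-- A finite-dimensional central simple algebra over a field `F`. -/
def IsCSA (F A : Type) [Field F] [Ring A] [Algebra F A] : Prop :=
  Algebra.IsCentral F A ∧ IsSimpleRing A ∧ FiniteDimensional F A

/-- An `F`-algebra is split if it is isomorphic to a matrix algebra over `F`. -/
def IsSplitAlg (F A : Type) [Field F] [Ring A] [Algebra F A] : Prop :=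
  ∃ n : ℕ, 0 < n ∧ Nonempty (A ≃ₐ[F] Matrix (Fin n) (Fin n) F)

/-- Brauer equivalence of two algebras over a field `F`. -/
def IsBrauerEquiv (F A B : Type) [Field F] [Ring A] [Algebra F A] [Ring B] [Algebra F B] :
    Prop :=
  ∃ n m : ℕ, 0 < n ∧ 0 < m ∧
    Nonempty ((Matrix (Fin n) (Fin n) A) ≃ₐ[F] (Matrix (Fin m) (Fin m) B))

/-- `A` has exponent `e`: `e` is the least positive integer such that the `e`-fold tensor
power of `A` over `F` is split. -/
def HasExponent (F A : Type) [Field F] [Ring A] [Algebra F A] (e : ℕ) : Prop :=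
  0 < e ∧ IsSplitAlg F (⨂[F] _ : Fin e, A) ∧
    ∀ k : ℕ, 0 < k → IsSplitAlg F (⨂[F] _ : Fin k, A) → e ≤ k

/-- `A` has (Schur) index `d`: `A` is isomorphic to a matrix algebra over a division
algebra of dimension `d ^ 2` over `F`. -/
def HasIndex (F A : Type) [Field F] [Ring A] [Algebra F A] (d : ℕ) : Prop :=
  ∃ (D : Type) (_ : DivisionRing D) (_ : Algebra F D) (m : ℕ), 0 < m ∧
    Nonempty (A ≃ₐ[F] Matrix (Fin m) (Fin m) D) ∧ Module.finrank F D = d ^ 2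

/-- The (Schur) index of `A` is at most `d`. -/
def IndexLE (F A : Type) [Field F] [Ring A] [Algebra F A] (d : ℕ) : Prop :=
  ∃ e : ℕ, e ≤ d ∧ HasIndex F A e

/-- `A` is the cyclic (symbol) algebra `[a, b)_{p,F}` of degree `p` in characteristic `p`:
it has dimension `p ^ 2` over `F` and is generated by elements `i`, `j` subject to
`i ^ p - i = a`, `j ^ p = b`, `j * i = (i - 1) * j`. -/
def IsCyclicAlgWith (p : ℕ) (F A : Type) [Field F] [Ring A] [Algebra F A] (a b : F) : Prop :=
  b ≠ 0 ∧ Module.finrank F A = p ^ 2 ∧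
    ∃ i j : A, i ^ p - i = algebraMap F A a ∧ j ^ p = algebraMap F A b ∧
      j * i = (i - 1) * j ∧ Algebra.adjoin F {i, j} = ⊤

/-- `A` is a cyclic algebra of degree `p`, i.e. of the form `[a, b)_{p,F}`. -/
def IsCyclicPAlg (p : ℕ) (F A : Type) [Field F] [Ring A] [Algebra F A] : Prop :=
  ∃ a b : F, IsCyclicAlgWith p F A a b

/-- The `p`-symbol length of `A` is at most `m`: `A` is Brauer equivalent to a tensor
product of at most `m` cyclic `F`-algebras of degree `p`. -/
def SymbolLengthLE (p : ℕ) (F A : Type) [Field F] [Ring A] [Algebra F A] (m : ℕ) : Prop :=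
  ∃ k : ℕ, k ≤ m ∧ ∃ (D : Fin k → Type) (_ : ∀ i, Ring (D i)) (_ : ∀ i, Algebra F (D i)),
    (∀ i, IsCyclicPAlg p F (D i)) ∧ IsBrauerEquiv F A (⨂[F] i, D i)

/-- `M` is a compositum `LK` of `L` and `K` over `F`: it is generated as an `F`-algebra by
the images of `L` and `K`. -/
def IsCompositum (F L K M : Type) [Field F] [Field L] [Field K] [Field M]
    [Algebra F L] [Algebra F K] [Algebra F M] [Algebra L M] [Algebra K M]
    [IsScalarTower F L M] [IsScalarTower F K M] : Prop :=
  (IsScalarTower.toAlgHom F L M).range ⊔ (IsScalarTower.toAlgHom F K M).range = ⊤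

/-- A cyclic algebra of degree `m` over `F`: a central simple `F`-algebra of degree `m`
containing a cyclic field extension of `F` of degree `m` (as a maximal subfield). -/
def IsCyclicAlgebra (F A : Type) [Field F] [Ring A] [Algebra F A] (m : ℕ) : Prop :=
  IsCSA F A ∧ Module.finrank F A = m ^ 2 ∧
  ∃ (L : Type) (_ : Field L) (_ : Algebra F L), IsGalois F L ∧ IsCyclic (L ≃ₐ[F] L) ∧
    Module.finrank F L = m ∧ Nonempty (L →ₐ[F] A)

/-- `L/F` is a `p`-extension: there is a tower of intermediate fields from `F` to `L`
each step of which is a cyclic extension of degree `p`. -/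
def IsPExtension (p : ℕ) (F L : Type) [Field F] [Field L] [Algebra F L] : Prop :=
  ∃ (n : ℕ) (T : Fin (n + 1) → IntermediateField F L),
    T 0 = ⊥ ∧ T (Fin.last n) = ⊤ ∧
    ∀ i : Fin n, ∃ h : T i.castSucc ≤ T i.succ,
      IsGalois (T i.castSucc) (IntermediateField.extendScalars h) ∧
      IsCyclic ((IntermediateField.extendScalars h) ≃ₐ[T i.castSucc]
        (IntermediateField.extendScalars h)) ∧
      Module.finrank (T i.castSucc) (IntermediateField.extendScalars h) = p

/-- `F` is `p`-cyclic reducible: for every central simple `F`-algebra `A` of exponent `p`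
and every purely inseparable extension `K/F` with `K ^ p ⊆ F`, either `A_K` is split, or
there is a separable extension `L/F` of degree `ind (A_K) / p` such that `A_{LK}` is
Brauer equivalent to a cyclic `LK`-algebra of degree `p`. -/
def IsPCyclicReducible (p : ℕ) (F : Type) [Field F] : Prop :=
  ∀ (A : Type) [Ring A] [Algebra F A], IsCSA F A → HasExponent F A p →
  ∀ (K : Type) [Field K] [Algebra F K], IsPurelyInseparable F K →
    (∀ z : K, z ^ p ∈ (algebraMap F K).range) →
    IsSplitAlg K (K ⊗[F] A) ∨
    ∃ d : ℕ, HasIndex K (K ⊗[F] A) (p * d) ∧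
      ∃ (L : Type) (_ : Field L) (_ : Algebra F L), Algebra.IsSeparable F L ∧
        Module.finrank F L = d ∧
        ∃ (M : Type) (_ : Field M) (_ : Algebra F M) (_ : Algebra L M) (_ : Algebra K M)
          (_ : IsScalarTower F L M) (_ : IsScalarTower F K M),
          IsCompositum F L K M ∧
          ∃ (C : Type) (_ : Ring C) (_ : Algebra M C),
            IsCyclicPAlg p M C ∧ IsBrauerEquiv M (M ⊗[F] A) C

/-- `F` is `p`-reducible: for every central simple `F`-algebra `A` of exponent `p`
and every purely inseparable extension `K/F` with `K ^ p ⊆ F`, either `A_K` is split, or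
there is a separable extension `L/F` of degree `ind (A_K) / p` with `ind A_{LK} = p`. -/
def IsPReducible (p : ℕ) (F : Type) [Field F] : Prop :=
  ∀ (A : Type) [Ring A] [Algebra F A], IsCSA F A → HasExponent F A p →
  ∀ (K : Type) [Field K] [Algebra F K], IsPurelyInseparable F K →
    (∀ z : K, z ^ p ∈ (algebraMap F K).range) →
    IsSplitAlg K (K ⊗[F] A) ∨
    ∃ d : ℕ, HasIndex K (K ⊗[F] A) (p * d) ∧
      ∃ (L : Type) (_ : Field L) (_ : Algebra F L), Algebra.IsSeparable F L ∧
        Module.finrank F L = d ∧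
        ∃ (M : Type) (_ : Field M) (_ : Algebra F M) (_ : Algebra L M) (_ : Algebra K M)
          (_ : IsScalarTower F L M) (_ : IsScalarTower F K M),
          IsCompositum F L K M ∧ HasIndex M (M ⊗[F] A) p

section SymbolAlgebra

variable {p : ℕ} {M B : Type*} [Field M] [Ring B] [Algebra M B] {i j : B}

/-- The relation `j * i = (i - 1) * j` propagates to powers of `j`. -/
theorem pow_mul_eq_sub_natCast_mul_pow (hji : j * i = (i - 1) * j) (l : ℕ) :
    j ^ l * i = (i - l) * j ^ l := by
  induction l with
  | zero => simp
  | succ l ih =>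
    have hl : j * (l : B) = l * j := (Nat.cast_commute l j).eq.symm
    rw [pow_succ', mul_assoc, ih, ← mul_assoc, mul_sub, hji, hl, ← mul_assoc]
    push_cast
    noncomm_ring

/-- The relation `j * i = (i - 1) * j` propagates to polynomials in `i`. -/
theorem mul_aeval_eq_aeval_sub_one_mul (hji : j * i = (i - 1) * j) (f : Polynomial M) :
    j * Polynomial.aeval i f = Polynomial.aeval (i - 1) f * j := by
  induction f using Polynomial.induction_on' with
  | add f g hf hg => simp [mul_add, add_mul, hf, hg]
  | monomial n c =>
    have hpow : j * i ^ n = (i - 1) ^ n * j :=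
      (show SemiconjBy j i (i - 1) from hji).pow_right n
    simp only [Polynomial.aeval_monomial]
    rw [← mul_assoc, ← Algebra.commutes, mul_assoc, hpow, mul_assoc]

theorem le_natDegree_minpoly_of_mul_eq_sub_one_mul [Nontrivial B] [CharP M p] (hp : p.Prime)
    (hi : IsIntegral M i) (hj : IsUnit j) (hji : j * i = (i - 1) * j) :
    p ≤ (minpoly M i).natDegree := by
  by_contra! hlt
  set f := minpoly M i
  have hmonic : f.Monic := minpoly.monic hi
  have hroot : Polynomial.aeval i (f.comp (Polynomial.X - Polynomial.C 1)) = 0 := by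
    have h := mul_aeval_eq_aeval_sub_one_mul hji f
    rw [minpoly.aeval, mul_zero, eq_comm, hj.mul_left_eq_zero] at h
    simpa [Polynomial.aeval_comp] using h
  have hcomp : f.comp (Polynomial.X - Polynomial.C 1) = f := by
    refine Polynomial.eq_of_monic_of_dvd_of_natDegree_le hmonic
      (hmonic.comp_X_sub_C 1) (minpoly.dvd M i hroot) ?_
    rw [Polynomial.natDegree_comp, Polynomial.natDegree_X_sub_C, mul_one]
  have heval (n : ℕ) : f.eval (-(n : M)) = f.eval 0 := by
    induction n with
    | zero => simp
    | succ n ih =>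
      rw [← ih]
      conv_rhs => rw [← hcomp]
      simp [Polynomial.eval_comp]
      ring_nf
  have hconst : f = Polynomial.C (f.eval 0) := by
    refine Polynomial.eq_of_degrees_lt_of_eval_index_eq (Finset.range p)
      (v := fun n : ℕ => -(n : M)) ?_ ?_ ?_ fun n _ => by simp [heval]
    · intro m hm n hn hmn
      exact CharP.natCast_injOn_Iio M p (by simpa using hm) (by simpa using hn)
        (neg_injective hmn)
    · simpa using Polynomial.degree_le_natDegree.trans_lt (Nat.cast_lt.2 hlt)
    · simpa using Polynomial.degree_C_le.trans_lt (Nat.cast_pos.2 hp.pos)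
  have hdeg : f.natDegree = 0 := by rw [hconst]; exact Polynomial.natDegree_C _
  exact (minpoly.natDegree_pos hi).ne' hdeg

/-- In a nontrivial algebra, the standard monomials in the generators of a symbol algebra are
linearly independent. -/
theorem linearIndependent_pow_mul_pow [Nontrivial B] [CharP M p] (hp : p.Prime)
    (hi : IsIntegral M i) (hj : IsUnit j) (hji : j * i = (i - 1) * j) :
    LinearIndependent M fun t : Fin p × Fin p => i ^ (t.1 : ℕ) * j ^ (t.2 : ℕ) := by
  have hpow : LinearIndependent M fun k : Fin p => i ^ (k : ℕ) :=
    (linearIndependent_pow i).comp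
      (Fin.castLE (le_natDegree_minpoly_of_mul_eq_sub_one_mul hp hi hj hji))
      (Fin.castLE_injective _)
  rw [Fintype.linearIndependent_iff] at hpow ⊢
  intro c hc
  let D : Module.End M B := LinearMap.mulLeft M i - LinearMap.mulRight M i
  let v : Fin p → B := fun l => ∑ k : Fin p, c (k, l) • (i ^ (k : ℕ) * j ^ (l : ℕ))
  have hv (l : Fin p) : v l ∈ D.eigenspace (l : M) := by
    refine Submodule.sum_mem _ fun k _ => Submodule.smul_mem _ _ ?_
    rw [Module.End.mem_eigenspace_iff]
    have h := pow_mul_eq_sub_natCast_mul_pow hji (l : ℕ)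
    simp only [D, LinearMap.sub_apply, LinearMap.mulLeft_apply, LinearMap.mulRight_apply]
    rw [mul_assoc, h, Nat.cast_smul_eq_nsmul, nsmul_eq_mul, sub_mul, mul_sub, ← mul_assoc,
      ← mul_assoc, ← pow_succ, ← pow_succ', sub_sub_cancel, ← mul_assoc, ← mul_assoc,
      (Nat.cast_commute (l : ℕ) (i ^ (k : ℕ))).eq]
  have hinj : Function.Injective fun l : Fin p => ((l : ℕ) : M) := fun l m hlm =>
    Fin.ext (CharP.natCast_injOn_Iio M p l.2 m.2 hlm)
  have hvzero := (iSupIndep_iff_finsetSum_eq_zero_imp_eq_zero _).1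
    (D.eigenspaces_iSupIndep.comp hinj) Finset.univ v (fun l _ => hv l)
    (by rw [← hc, Fintype.sum_prod_type_right])
  rintro ⟨k, l⟩
  refine hpow (fun k => c (k, l)) ?_ k
  have h := hvzero l (Finset.mem_univ l)
  simp only [v, ← smul_mul_assoc, ← Finset.sum_mul] at h
  exact (hj.pow (l : ℕ)).mul_left_eq_zero.1 h

end SymbolAlgebra

/-- An algebra of dimension `p ^ 2` generated like a symbol algebra `[a, 1)` is split. -/
theorem isSplitAlg_of_pow_eq_one {p : ℕ} (hp : p.Prime) {M A : Type} [Field M] [CharP M p]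
    [Ring A] [Algebra M A] (hA : Module.finrank M A = p ^ 2) {i j : A}
    (hj : j ^ p = 1) (hji : j * i = (i - 1) * j) :
    IsSplitAlg M A := by
  have hpos : 0 < p ^ 2 := pow_pos hp.pos 2
  have hfin : FiniteDimensional M A := Module.finite_of_finrank_pos (hA ▸ hpos)
  have hnon : Nontrivial A := Module.nontrivial_of_finrank_pos (R := M) (hA ▸ hpos)
  have hju : IsUnit j := IsUnit.of_pow_eq_one hj hp.ne_zero
  have hlin := linearIndependent_pow_mul_pow (M := M) hp (.of_finite M i) hju hji
  have hspan := hlin.span_eq_top_of_card_eq_finrank' (by simp [hA, sq])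
  let y : A := ∑ l ∈ Finset.range p, j ^ l
  have hjy : j * y = y := by
    have h := mul_geom_sum j p
    rwa [hj, sub_self, sub_mul, one_mul, sub_eq_zero] at h
  have hjy' (l : ℕ) : j ^ l * y = y := by
    induction l with
    | zero => simp
    | succ l ih => rw [pow_succ, mul_assoc, hjy, ih]
  have hy : y ≠ 0 := by
    intro hy
    have h0 : LinearIndependent M fun l : Fin p => j ^ (l : ℕ) := by
      simpa [Function.comp_def] using
        hlin.comp (fun l : Fin p => ((⟨0, hp.pos⟩ : Fin p), l)) (Prod.mk_right_injective _)
    have h1 := Fintype.linearIndependent_iff.1 h0 (fun _ => 1)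
      (by simpa [y, Finset.sum_range] using hy) ⟨0, hp.pos⟩
    exact one_ne_zero h1
  let V : Submodule A A := Submodule.span A {y}
  have hVnon : Nontrivial V :=
    ⟨⟨y, Submodule.mem_span_singleton_self y⟩, 0, fun h => hy (congrArg Subtype.val h)⟩
  let W : Submodule M A := Submodule.span M (Set.range fun k : Fin p => i ^ (k : ℕ) * y)
  have hVW : V.restrictScalars M ≤ W := by
    intro z hz
    obtain ⟨x, rfl⟩ := Submodule.mem_span_singleton.1 hz
    clear hz
    have hx : x ∈ Submodule.span M (Set.range fun t : Fin p × Fin p =>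
      i ^ (t.1 : ℕ) * j ^ (t.2 : ℕ)) := hspan ▸ Submodule.mem_top
    induction hx using Submodule.span_induction with
    | mem x hx =>
      obtain ⟨t, rfl⟩ := hx
      rw [smul_eq_mul, mul_assoc, hjy']
      exact Submodule.subset_span ⟨t.1, rfl⟩
    | zero => simp
    | add x z _ _ hx hz =>
      rw [add_smul]
      exact add_mem hx hz
    | smul c x _ hx =>
      rw [smul_assoc]
      exact W.smul_mem c hx
  have hVfin : FiniteDimensional M V :=
    inferInstanceAs (FiniteDimensional M (V.restrictScalars M))
  have hVle : Module.finrank M V ≤ p :=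
    (Submodule.finrank_mono hVW).trans <|
      (finrank_range_le_card fun k : Fin p => i ^ (k : ℕ) * y).trans_eq (Fintype.card_fin p)
  let φ : A →ₐ[M] Module.End M V := Algebra.lsmul M M V
  have hφlin : LinearIndependent M (φ.toLinearMap ∘ fun t : Fin p × Fin p =>
      i ^ (t.1 : ℕ) * j ^ (t.2 : ℕ)) := by
    have h : φ j * φ i = (φ i - 1) * φ j := by rw [← map_mul, hji]; simp
    simpa [Function.comp_def] using
      linearIndependent_pow_mul_pow (M := M) hp (.of_finite M (φ i)) (hju.map φ) h
  have hend : Module.finrank M (Module.End M V) = Module.finrank M V ^ 2 := by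
    rw [Module.finrank_linearMap, sq]
  have hge : p ^ 2 ≤ Module.finrank M V ^ 2 := by
    have h := hφlin.fintype_card_le_finrank
    rwa [hend, Fintype.card_prod, Fintype.card_fin, ← sq] at h
  have hVp : Module.finrank M V = p :=
    le_antisymm hVle ((Nat.pow_le_pow_iff_left two_ne_zero).1 hge)
  have hsurj : Function.Surjective φ := by
    have h := hφlin.span_eq_top_of_card_eq_finrank' (by simp [hend, hVp, sq])
    rw [Set.range_comp, ← Submodule.map_span, hspan, Submodule.map_top] at h
    exact LinearMap.range_eq_top.1 h
  have hinj : Function.Injective φ :=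
    (LinearMap.injective_iff_surjective_of_finrank_eq_finrank (f := φ.toLinearMap)
      (by rw [hA, hend, hVp])).2 hsurj
  exact ⟨p, hp.pos, ⟨(AlgEquiv.ofBijective φ ⟨hinj, hsurj⟩).trans
    (algEquivMatrix (Module.finBasisOfFinrankEq M V hVp))⟩⟩

/-- Some `p`-power power of an algebraic element `b` is separable, with exponent controlled by the
degree of `b`. -/
theorem exists_isSeparable_pow {p : ℕ} (hp : p.Prime) {F L : Type*} [Field F] [CharP F p]
    [Field L] [Algebra F L] [FiniteDimensional F L] (b : L) :
    ∃ r : ℕ, IsSeparable F (b ^ p ^ r) ∧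
      (r + 1) * Module.finrank F (IntermediateField.adjoin F {b ^ p ^ r}) ≤ Module.finrank F L := by
  have : Fact p.Prime := ⟨hp⟩
  have hb : IsIntegral F b := .of_finite F b
  have hirr := minpoly.irreducible hb
  obtain ⟨r, g, hg, hexp⟩ := Polynomial.exists_separable_of_irreducible p hirr hp.ne_zero
  have hroot : Polynomial.aeval (b ^ p ^ r) g = 0 := by
    rw [← Polynomial.expand_aeval, hexp, minpoly.aeval]
  refine ⟨r, hg.of_dvd (minpoly.dvd F _ hroot), ?_⟩
  rw [IntermediateField.adjoin.finrank (.of_finite F _)]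
  calc (r + 1) * (minpoly F (b ^ p ^ r)).natDegree
      ≤ p ^ r * g.natDegree := by
        gcongr
        · exact Nat.lt_pow_self hp.one_lt
        · exact Polynomial.natDegree_le_of_dvd (minpoly.dvd F _ hroot) hg.ne_zero
    _ = (minpoly F b).natDegree := by rw [← hexp, Polynomial.natDegree_expand, mul_comm]
    _ ≤ Module.finrank F L := minpoly.natDegree_le b

/-- Adjoining finitely many elements of degree at most `q` multiplies the degree by at most `q`
each time. -/
theorem finrank_adjoin_range_le {F Ω ι : Type*} [Field F] [Field Ω] [Algebra F Ω] [Fintype ι]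
    (d : ι → Ω) {q : ℕ} (hq : ∀ k, Module.finrank F (IntermediateField.adjoin F {d k}) ≤ q) :
    Module.finrank F (IntermediateField.adjoin F (Set.range d)) ≤ q ^ Fintype.card ι := by
  classical
  suffices h : ∀ s : Finset ι,
      Module.finrank F (IntermediateField.adjoin F (Set.image d s)) ≤ q ^ s.card by
    rw [← Set.image_univ, ← Finset.coe_univ, ← Finset.card_univ]
    exact h Finset.univ
  intro s
  induction s using Finset.induction_on with
  | empty =>
    rw [Finset.coe_empty, Set.image_empty, IntermediateField.adjoin_empty]
    simp
  | insert k s hk ih =>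
    rw [Finset.coe_insert, Set.image_insert_eq, Set.insert_eq, IntermediateField.adjoin_union,
      Finset.card_insert_of_notMem hk, pow_succ']
    exact (IntermediateField.finrank_sup_le _ _).trans (Nat.mul_le_mul (hq k) ih)

/-- Adjoining `p ^ n`-th roots of elements of the base field only yields such roots. -/
theorem pow_mem_range_of_mem_adjoin {p : ℕ} (hp : p.Prime) {F Ω : Type*} [Field F] [CharP F p]
    [Field Ω] [Algebra F Ω] {n : ℕ} {S : Set Ω}
    (hS : ∀ x ∈ S, x ^ p ^ n ∈ (algebraMap F Ω).range) {z : Ω}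
    (hz : z ∈ IntermediateField.adjoin F S) : z ^ p ^ n ∈ (algebraMap F Ω).range := by
  have : Fact p.Prime := ⟨hp⟩
  have : CharP Ω p := charP_of_injective_algebraMap (algebraMap F Ω).injective p
  induction hz using IntermediateField.adjoin_induction with
  | mem x hx => exact hS x hx
  | algebraMap x => exact ⟨x ^ p ^ n, by simp⟩
  | add x y _ _ hx hy => rw [add_pow_char_pow]; exact add_mem hx hy
  | inv x _ hx =>
    obtain ⟨c, hc⟩ := hx
    exact ⟨c⁻¹, by simp [hc]⟩
  | mul x y _ _ hx hy => rw [mul_pow]; exact mul_mem hx hy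

/-- If `b ^ p ^ r` is separable over `F`, then `b` becomes a `p`-th power in the compositum with a
purely inseparable extension obtained by adjoining `p ^ (r + 1)`-th roots. -/
theorem exists_pow_eq_of_isSeparable_pow {p : ℕ} (hp : p.Prime) {F L : Type*} [Field F] [CharP F p]
    [Field L] [Algebra F L] [FiniteDimensional F L] {Ω : Type*} [Field Ω] [IsAlgClosed Ω]
    [Algebra F Ω] [Algebra L Ω] [IsScalarTower F L Ω] (b : L) (r : ℕ)
    (hsep : IsSeparable F (b ^ p ^ r)) :
    ∃ K : IntermediateField F Ω, (∀ z ∈ K, z ^ p ^ (r + 1) ∈ (algebraMap F Ω).range) ∧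
      FiniteDimensional F K ∧
      Module.finrank F K ≤
        p ^ ((r + 1) * Module.finrank F (IntermediateField.adjoin F {b ^ p ^ r})) ∧
      ∃ β ∈ (IsScalarTower.toAlgHom F L Ω).fieldRange ⊔ K, β ^ p = algebraMap L Ω b := by
  have : Fact p.Prime := ⟨hp⟩
  have : CharP Ω p := charP_of_injective_algebraMap (algebraMap F Ω).injective p
  have hq : 0 < p ^ (r + 1) := pow_pos hp.pos _
  let E := IntermediateField.adjoin F {b ^ p ^ r}
  have : Algebra.IsSeparable F E :=
    (IntermediateField.isSeparable_adjoin_simple_iff_isSeparable F L).2 hsep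
  let e := Module.finBasis F E
  let e' := e.mapPowExpCharPowOfIsSeparable p (r + 1)
  let s : E := ⟨b ^ p ^ r, IntermediateField.mem_adjoin_simple_self F _⟩
  have he' (k) : e' k = e k ^ p ^ (r + 1) := by
    simp [e', Module.Basis.mapPowExpCharPowOfIsSeparable]
  choose d hd using fun k =>
    IsAlgClosed.exists_pow_nat_eq (algebraMap F Ω (e'.repr s k)) hq
  have hint (k) : IsIntegral F (d k) := .of_pow hq (hd k ▸ isIntegral_algebraMap)
  refine ⟨IntermediateField.adjoin F (Set.range d), fun z hz => ?_, ?_, ?_,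
    ∑ k, d k * algebraMap L Ω (e k), ?_, ?_⟩
  · refine pow_mem_range_of_mem_adjoin hp ?_ hz
    rintro _ ⟨k, rfl⟩
    exact ⟨_, (hd k).symm⟩
  · refine IntermediateField.finiteDimensional_adjoin ?_
    rintro _ ⟨k, rfl⟩
    exact hint k
  · have h := finrank_adjoin_range_le (F := F) d (q := p ^ (r + 1)) fun k => by
      rw [IntermediateField.adjoin.finrank (hint k)]
      let f : Polynomial F := Polynomial.X ^ p ^ (r + 1) - Polynomial.C (e'.repr s k)
      have hf : f ≠ 0 := Polynomial.X_pow_sub_C_ne_zero hq _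
      calc _ ≤ f.natDegree :=
            Polynomial.natDegree_le_of_dvd (minpoly.dvd F _ (by simp [f, hd])) hf
        _ = _ := Polynomial.natDegree_X_pow_sub_C
    rwa [Fintype.card_fin, ← pow_mul] at h
  · refine sum_mem fun k _ => mul_mem ?_ ?_
    · exact (le_sup_right : IntermediateField.adjoin F (Set.range d) ≤ _)
        (IntermediateField.subset_adjoin F _ ⟨k, rfl⟩)
    · exact (le_sup_left : (IsScalarTower.toAlgHom F L Ω).fieldRange ≤ _) ⟨e k, rfl⟩
  · apply iterateFrobenius_inj Ω p r
    rw [iterateFrobenius_def, iterateFrobenius_def, ← pow_mul, ← pow_succ', sum_pow_char_pow,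
      ← map_pow]
    have hs : (s : L) = b ^ p ^ r := rfl
    rw [← hs, ← e'.sum_repr s, AddSubmonoidClass.coe_finsetSum, map_sum]
    refine Finset.sum_congr rfl fun k _ => ?_
    rw [mul_pow, hd, ← map_pow, he', IntermediateField.coe_smul, Algebra.smul_def, map_mul,
      ← IsScalarTower.algebraMap_apply]
    simp

/-- The base change of a symbol algebra `[a, b)` to a field where `b` is a `p`-th power is split. -/
theorem isSplitAlg_baseChange_of_pow_eq {p : ℕ} (hp : p.Prime) {L C M : Type} [Field L] [Ring C]
    [Algebra L C] [Field M] [Algebra L M] [CharP M p] {a b : L} (hC : IsCyclicAlgWith p L C a b)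
    {β : M} (hβ : β ^ p = algebraMap L M b) : IsSplitAlg M (M ⊗[L] C) := by
  obtain ⟨hb, hfin, i, j, -, hj, hji, -⟩ := hC
  have hβ0 : algebraMap L M b ≠ 0 := by simpa using hb
  refine isSplitAlg_of_pow_eq_one hp (i := 1 ⊗ₜ i) (j := β⁻¹ ⊗ₜ j)
    (by rw [Module.finrank_baseChange, hfin]) ?_ ?_
  · rw [Algebra.TensorProduct.tmul_pow, hj, Algebra.algebraMap_eq_smul_one, TensorProduct.tmul_smul,
      TensorProduct.smul_tmul', Algebra.smul_def, inv_pow, hβ, mul_inv_cancel₀ hβ0,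
      Algebra.TensorProduct.one_def]
  · rw [Algebra.TensorProduct.one_def, ← TensorProduct.tmul_sub,
      Algebra.TensorProduct.tmul_mul_tmul, Algebra.TensorProduct.tmul_mul_tmul, hji, mul_one,
      one_mul]

/-- A symbol algebra `[a, b)` over `L` such that `b ^ p ^ r` is separable over `F` is split by the
compositum with a purely inseparable extension of `F` of exponent at most `r + 1`. -/
theorem exists_isPurelyInseparable_isSplitAlg {p : ℕ} (hp : p.Prime) {F : Type} [Field F]
    [CharP F p] {L : Type} [Field L] [Algebra F L] [FiniteDimensional F L]
    {C : Type} [Ring C] [Algebra L C] {a b : L} (hC : IsCyclicAlgWith p L C a b) {r : ℕ}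
    (hsep : IsSeparable F (b ^ p ^ r)) :
    ∃ (K : Type) (_ : Field K) (_ : Algebra F K), IsPurelyInseparable F K ∧
      FiniteDimensional F K ∧ (∀ z : K, z ^ p ^ (r + 1) ∈ (algebraMap F K).range) ∧
      Module.finrank F K ≤
        p ^ ((r + 1) * Module.finrank F (IntermediateField.adjoin F {b ^ p ^ r})) ∧
      ∃ (M : Type) (_ : Field M) (_ : Algebra F M) (_ : Algebra L M) (_ : Algebra K M)
        (_ : IsScalarTower F L M) (_ : IsScalarTower F K M),
        IsCompositum F L K M ∧ IsSplitAlg M (M ⊗[L] C) := by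
  have : Fact p.Prime := ⟨hp⟩
  obtain ⟨K, hK, hKfin, hKle, β, hβ, hβb⟩ :=
    exists_pow_eq_of_isSeparable_pow (Ω := AlgebraicClosure L) hp b r hsep
  let φ := IsScalarTower.toAlgHom F L (AlgebraicClosure L)
  let M := φ.fieldRange ⊔ K
  have hKpow (z : K) : z ^ p ^ (r + 1) ∈ (algebraMap F K).range := by
    obtain ⟨c, hc⟩ := hK z z.2
    exact ⟨c, Subtype.ext hc⟩
  let ψ : L →ₐ[F] M := (IntermediateField.inclusion le_sup_left).comp φ.rangeRestrict
  let χ : K →ₐ[F] M := IntermediateField.inclusion le_sup_right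
  let : Algebra L M := ψ.toRingHom.toAlgebra
  let : Algebra K M := χ.toRingHom.toAlgebra
  have : IsScalarTower F L M := .of_algebraMap_eq fun x => (ψ.commutes x).symm
  have : IsScalarTower F K M := .of_algebraMap_eq fun x => (χ.commutes x).symm
  have : CharP M p := charP_of_injective_algebraMap (algebraMap F M).injective p
  refine ⟨K, inferInstance, inferInstance,
    (isPurelyInseparable_iff_pow_mem F p).2 fun z => ⟨r + 1, hKpow z⟩, hKfin, hKpow, hKle,
    M, inferInstance, inferInstance, inferInstance, inferInstance, inferInstance, inferInstance,
    ?_, isSplitAlg_baseChange_of_pow_eq hp hC (β := ⟨β, hβ⟩) (Subtype.ext hβb)⟩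
  refine Subalgebra.map_injective (f := M.val) M.val.injective ?_
  have hψ : M.val.comp (IsScalarTower.toAlgHom F L M) = φ := rfl
  have hχ : M.val.comp (IsScalarTower.toAlgHom F K M) = K.val := rfl
  rw [Algebra.map_sup, ← AlgHom.range_comp, ← AlgHom.range_comp, hψ, hχ, Algebra.map_top,
    IntermediateField.range_val, IntermediateField.range_val,
    IntermediateField.sup_toSubalgebra_of_right]
  rfl


/-- Any cyclic algebra of degree `p` over a finite extension `L/F` in
characteristic `p` is split by the compositum `LK` for some purely inseparable extension
`K/F` of degree at most `p ^ [L:F]`; if `L/F` is separable, `K` can moreover be chosen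
with `K ^ p ⊆ F`. -/
theorem statement0 (p : ℕ) (hp : p.Prime) (F : Type) [Field F] [CharP F p]
    (L : Type) [Field L] [Algebra F L] [FiniteDimensional F L]
    (C : Type) [Ring C] [Algebra L C] (hC : IsCyclicPAlg p L C) :
    (∃ (K : Type) (_ : Field K) (_ : Algebra F K), IsPurelyInseparable F K ∧
      FiniteDimensional F K ∧ Module.finrank F K ≤ p ^ Module.finrank F L ∧
      ∃ (M : Type) (_ : Field M) (_ : Algebra F M) (_ : Algebra L M) (_ : Algebra K M)
        (_ : IsScalarTower F L M) (_ : IsScalarTower F K M),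
        IsCompositum F L K M ∧ IsSplitAlg M (M ⊗[L] C)) ∧
    (Algebra.IsSeparable F L →
      ∃ (K : Type) (_ : Field K) (_ : Algebra F K), IsPurelyInseparable F K ∧
        FiniteDimensional F K ∧ (∀ z : K, z ^ p ∈ (algebraMap F K).range) ∧
        Module.finrank F K ≤ p ^ Module.finrank F L ∧
        ∃ (M : Type) (_ : Field M) (_ : Algebra F M) (_ : Algebra L M) (_ : Algebra K M)
          (_ : IsScalarTower F L M) (_ : IsScalarTower F K M),
          IsCompositum F L K M ∧ IsSplitAlg M (M ⊗[L] C)) := by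
  obtain ⟨a, b, hC⟩ := hC
  refine ⟨?_, fun hsep => ?_⟩
  · obtain ⟨r, hr, hle⟩ := exists_isSeparable_pow (F := F) hp b
    obtain ⟨K, iK, iFK, hpi, hfin, -, hdeg, hM⟩ :=
      exists_isPurelyInseparable_isSplitAlg hp hC hr
    exact ⟨K, iK, iFK, hpi, hfin, hdeg.trans (Nat.pow_le_pow_right hp.pos hle), hM⟩
  · obtain ⟨K, iK, iFK, hpi, hfin, hpow, hdeg, hM⟩ :=
      exists_isPurelyInseparable_isSplitAlg (r := 0) hp hC
        (Algebra.IsSeparable.isSeparable F (b ^ p ^ 0))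
    refine ⟨K, iK, iFK, hpi, hfin, by simpa using hpow,
      hdeg.trans (Nat.pow_le_pow_right hp.pos ?_), hM⟩
    rw [zero_add, one_mul]
    exact (IntermediateField.adjoin F {b ^ p ^ 0}).toSubmodule.finrank_le
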